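/- Let T > 0 and let σ₊, σ₋ : [0,T] × ℝ² → ℝ be a smooth solution of the unscreened right-handed system ∂ₜσ₊ − 𝕌(σ₋)·∇σ₊ = 0, ∂ₜσ₋ + 𝕌(σ₊)·∇σ₋ = 0, with σ±(t,·) compactly supported for each t. Assume that for all t ∈ [0,T]: (i) the symmetry conditions σ±(t, x₁, x₂) = −σ±(t, −x₁, x₂) and σ₊(t, x₁, x₂) = σ₋(t, x₁, −x₂) hold; (ii) {x : |σ₊(t,x)| > 0} ⊂ {x₂ > 0}; (iii) σ₊(t,·) is either nonpositive on Q or nonnegative on Q. Then E₂(t) := ∫_Q x₂ σ₊(t,x) dx is differentiable in t and E₂′(t) = (1/(2π)) ∫_{Q×Q} [ (x₁ + y₁) / |x + y|² ] σ₊(t,y) σ₊(t,x) dy dx; moreover E₂′(t) > 0 whenever σ₊(t,·) is not identically zero on Q. -/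

import Mathlib

open MeasureTheory ENNReal Set Real

noncomputable section

/-- The perpendicular rotation `(z₁, z₂)^⊥ = (−z₂, z₁)` in the plane. -/
def perp (z : EuclideanSpace ℝ (Fin 2)) : EuclideanSpace ℝ (Fin 2) :=
  (WithLp.equiv 2 (Fin 2 → ℝ)).symm ![-(z 1), z 0]

/-- The Biot–Savart velocity `𝕌(ω)(x) = (1/2π) ∫ ((x−y)^⊥/|x−y|²) ω(y) dy`. -/
def biotSavart (ω : EuclideanSpace ℝ (Fin 2) → ℝ) (x : EuclideanSpace ℝ (Fin 2)) :
    EuclideanSpace ℝ (Fin 2) :=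
  (1 / (2 * Real.pi)) • ∫ y, (ω y / ‖x - y‖ ^ 2) • perp (x - y)

/-- Reflection across the `x₁`-axis: `(x₁, x₂) ↦ (x₁, −x₂)`. -/
def reflect₂ (x : EuclideanSpace ℝ (Fin 2)) : EuclideanSpace ℝ (Fin 2) :=
  (WithLp.equiv 2 (Fin 2 → ℝ)).symm ![x 0, -(x 1)]

/-- Reflection across the `x₂`-axis: `(x₁, x₂) ↦ (−x₁, x₂)`. -/
def reflect₁ (x : EuclideanSpace ℝ (Fin 2)) : EuclideanSpace ℝ (Fin 2) :=
  (WithLp.equiv 2 (Fin 2 → ℝ)).symm ![-(x 0), x 1]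

/-- The open first quadrant `Q = (0,∞)²`. -/
def Quadrant : Set (EuclideanSpace ℝ (Fin 2)) := {x | 0 < x 0 ∧ 0 < x 1}

/-- The maximum principle on backward cones for transport with velocity at most `V`. -/
theorem transport_le {E : Type*} [NormedAddCommGroup E] [NormedSpace ℝ E] [ProperSpace E]
    {g : ℝ → E → ℝ} (hg : Differentiable ℝ fun p : ℝ × E => g p.1 p.2)
    {a b V : ℝ} (hab : a ≤ b) (hV : 0 ≤ V)
    (H : ∀ t ∈ Icc a b, ∀ x, ∃ v, ‖v‖ ≤ V ∧
      deriv (fun s => g s x) t = fderiv ℝ (g t) x v)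
    {x₀ : E} {m : ℝ} (hm : ∀ x ∈ Metric.closedBall x₀ (V * (b - a)), g a x ≤ m) :
    g b x₀ ≤ m := by
  have key : ∀ ε > 0, g b x₀ ≤ m + ε * (b - a) := by
    intro ε hε
    set D : Set (ℝ × E) := {p | p.1 ∈ Icc a b ∧ ‖p.2 - x₀‖ ≤ V * (b - p.1)} with hD
    have hDc : IsCompact D := by
      refine ((isCompact_Icc (a := a) (b := b)).prod
        (isCompact_closedBall x₀ (V * (b - a)))).of_isClosed_subset ?_ ?_
      · refine IsClosed.inter (isClosed_Icc.preimage continuous_fst) ?_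
        exact isClosed_le (f := fun p : ℝ × E => ‖p.2 - x₀‖)
          (g := fun p : ℝ × E => V * (b - p.1)) (by fun_prop) (by fun_prop)
      · rintro ⟨t, x⟩ ⟨ht, hx⟩
        refine ⟨ht, ?_⟩
        rw [mem_closedBall_iff_norm]
        refine hx.trans (mul_le_mul_of_nonneg_left ?_ hV)
        have := ht.1
        dsimp only at this ⊢
        linarith
    have hb : (b, x₀) ∈ D := ⟨⟨hab, le_rfl⟩, by simp⟩
    have hcont : ContinuousOn (fun p : ℝ × E => g p.1 p.2 - ε * (p.1 - a)) D :=
      (hg.continuous.sub (by fun_prop)).continuousOn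
    obtain ⟨⟨t, x⟩, ⟨ht, hx⟩, hmax⟩ := hDc.exists_isMaxOn ⟨_, hb⟩ hcont
    dsimp only at ht hx
    rcases ht.1.eq_or_lt with rfl | hat
    · have h1 := hmax hb
      have h2 := hm x (by rwa [mem_closedBall_iff_norm])
      simp only [mem_ofPred_eq, sub_self, mul_zero, sub_zero] at h1
      linarith
    · exfalso
      obtain ⟨v, hv, hder⟩ := H t ht x
      set L := fderiv ℝ (fun p : ℝ × E => g p.1 p.2) (t, x) with hL
      have hL' : HasFDerivAt (fun p : ℝ × E => g p.1 p.2) L (t, x) := (hg _).hasFDerivAt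
      have e1 : deriv (fun s => g s x) t = L (1, 0) := by
        have : HasDerivAt (fun s : ℝ => (s, x)) ((1 : ℝ), (0 : E)) t :=
          (hasDerivAt_id t).prodMk (hasDerivAt_const t x)
        exact (hL'.comp_hasDerivAt t this).deriv
      have e2 : fderiv ℝ (g t) x v = L (0, v) := by
        have : HasFDerivAt (fun y : E => (t, y))
            ((0 : E →L[ℝ] ℝ).prod (ContinuousLinearMap.id ℝ E)) x :=
          (hasFDerivAt_const t x).prodMk (hasFDerivAt_id x)
        have h3 := (HasFDerivAt.comp (g := fun p : ℝ × E => g p.1 p.2) x hL' this).fderiv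
        have h4 : fderiv ℝ (g t) x = L.comp
            ((0 : E →L[ℝ] ℝ).prod (ContinuousLinearMap.id ℝ E)) := h3
        rw [h4]
        simp
      have e3 : L (-1, v) = 0 := by
        have : ((-1 : ℝ), v) = (0, v) - (1, 0) := by simp
        rw [this, map_sub, ← e1, ← e2, hder, sub_self]
      have hp : HasDerivAt (fun h : ℝ => g (t - h) (x + h • v)) 0 0 := by
        have hc : HasDerivAt (fun h : ℝ => (t - h, x + h • v)) ((-1 : ℝ), v) 0 := by
          have h5 : HasDerivAt (fun h : ℝ => t - h) (-1) 0 := by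
            simpa using (hasDerivAt_id (0 : ℝ)).const_sub t
          have h6 : HasDerivAt (fun h : ℝ => x + h • v) v 0 := by
            simpa using ((hasDerivAt_id (0 : ℝ)).smul_const v).const_add x
          exact h5.prodMk h6
        have hL0 : HasFDerivAt (fun p : ℝ × E => g p.1 p.2) L (t - 0, x + (0 : ℝ) • v) := by
          simpa using hL'
        have h7 := HasFDerivAt.comp_hasDerivAt (l := fun p : ℝ × E => g p.1 p.2) 0 hL0 hc
        rw [e3] at h7
        exact h7
      have hs := hp.tendsto_slope.mono_left
        (nhdsWithin_mono (0 : ℝ) (fun y (hy : 0 < y) => ne_of_gt hy) :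
          nhdsWithin (0 : ℝ) (Ioi 0) ≤ _)
      have hs1 := hs.eventually (lt_mem_nhds (show -ε < 0 by linarith))
      have hs2 : ∀ᶠ h in nhdsWithin (0 : ℝ) (Ioi 0), h ∈ Ioo 0 (t - a) :=
        Ioo_mem_nhdsGT (by linarith)
      obtain ⟨h, hh1, hh2⟩ := (hs1.and hs2).exists
      rw [slope_def_field, lt_div_iff₀ (by simpa using hh2.1)] at hh1
      have hmem : (t - h, x + h • v) ∈ D := by
        refine ⟨⟨by linarith [hh2.2], by linarith [hh2.1, ht.2]⟩, ?_⟩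
        have : ‖x + h • v - x₀‖ ≤ ‖x - x₀‖ + h * V := by
          calc ‖x + h • v - x₀‖ = ‖(x - x₀) + h • v‖ := by congr 1; abel
            _ ≤ ‖x - x₀‖ + ‖h • v‖ := norm_add_le _ _
            _ ≤ _ := by
              rw [norm_smul, Real.norm_of_nonneg hh2.1.le]
              gcongr
              exact hh2.1.le
        dsimp only
        linarith
      have h8 := hmax hmem
      simp only [mem_ofPred_eq] at h8
      simp only [sub_zero, zero_smul, add_zero] at hh1
      linarith
  refine le_of_forall_pos_le_add fun δ hδ => ?_
  have h9 := key (δ / (b - a + 1)) (by have := sub_nonneg.2 hab; positivity)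
  refine h9.trans ?_
  have h10 : 0 ≤ b - a := sub_nonneg.2 hab
  have : δ / (b - a + 1) * (b - a) ≤ δ := by
    rw [div_mul_eq_mul_div, div_le_iff₀ (by positivity)]
    nlinarith
  linarith

theorem transport_abs_le_forward {E : Type*} [NormedAddCommGroup E] [NormedSpace ℝ E]
    [ProperSpace E] {g : ℝ → E → ℝ} (hg : Differentiable ℝ fun p : ℝ × E => g p.1 p.2)
    {a b V : ℝ} (hab : a ≤ b) (hV : 0 ≤ V)
    (H : ∀ t ∈ Icc a b, ∀ x, ∃ v, ‖v‖ ≤ V ∧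
      deriv (fun s => g s x) t = fderiv ℝ (g t) x v)
    {x₀ : E} {m : ℝ} (hm : ∀ x ∈ Metric.closedBall x₀ (V * (b - a)), |g a x| ≤ m) :
    |g b x₀| ≤ m := by
  rw [abs_le']
  refine ⟨transport_le hg hab hV H fun x hx => (abs_le'.1 (hm x hx)).1,
    transport_le (g := fun t x => -g t x) hg.neg hab hV (fun t ht x => ?_)
      fun x hx => (abs_le'.1 (hm x hx)).2⟩
  obtain ⟨v, hv, h⟩ := H t ht x
  refine ⟨v, hv, ?_⟩
  have h1 : fderiv ℝ (fun x => -g t x) x = -fderiv ℝ (g t) x := fderiv_neg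
  rw [deriv.fun_neg, h1, h]
  rfl

/-- Bounds for a transported quantity propagate along cones, in both time directions. -/
theorem transport_abs_le {E : Type*} [NormedAddCommGroup E] [NormedSpace ℝ E]
    [ProperSpace E] {g : ℝ → E → ℝ} (hg : Differentiable ℝ fun p : ℝ × E => g p.1 p.2)
    {a b V : ℝ} (hV : 0 ≤ V)
    (H : ∀ t ∈ uIcc a b, ∀ x, ∃ v, ‖v‖ ≤ V ∧
      deriv (fun s => g s x) t = fderiv ℝ (g t) x v)
    {x₀ : E} {m : ℝ} (hm : ∀ x ∈ Metric.closedBall x₀ (V * |b - a|), |g a x| ≤ m) :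
    |g b x₀| ≤ m := by
  rcases le_total a b with hab | hab
  · rw [uIcc_of_le hab] at H
    rw [abs_of_nonneg (sub_nonneg.2 hab)] at hm
    exact transport_abs_le_forward hg hab hV H hm
  · rw [uIcc_of_ge hab] at H
    rw [abs_sub_comm, abs_of_nonneg (sub_nonneg.2 hab)] at hm
    have hg' : Differentiable ℝ fun p : ℝ × E => g (-p.1) p.2 :=
      hg.comp (f := fun p : ℝ × E => (-p.1, p.2)) (by fun_prop)
    have := transport_abs_le_forward (g := fun t x => g (-t) x) hg' (neg_le_neg hab) hV
      (x₀ := x₀) (m := m) (fun t ht x => ?_) ?_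
    · simpa using this
    · obtain ⟨v, hv, h⟩ := H (-t) ⟨by linarith [ht.2], by linarith [ht.1]⟩ x
      refine ⟨-v, by rwa [norm_neg], ?_⟩
      rw [deriv_comp_neg (fun s => g s x), h, map_neg]
    · simpa [neg_add_eq_sub] using hm

theorem integrable_indicator_ball_inv_norm (R : ℝ) :
    Integrable ((Metric.ball (0 : EuclideanSpace ℝ (Fin 2)) R).indicator fun z => ‖z‖⁻¹) := by
  rw [integrable_indicator_iff measurableSet_ball,
    integrableOn_fun_norm_addHaar volume (f := fun r : ℝ => r⁻¹)]
  simp only [finrank_euclideanSpace, Fintype.card_fin, Nat.add_one_sub_one, pow_one, smul_eq_mul]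
  refine (integrableOn_const (C := (1 : ℝ)) (s := Ioo (0 : ℝ) R) (by simp)).congr_fun
    (fun x hx => ?_) measurableSet_Ioo
  exact (mul_inv_cancel₀ hx.1.ne').symm

theorem integral_indicator_ball_inv_norm {R : ℝ} (hR : 0 ≤ R) :
    ∫ z, (Metric.ball (0 : EuclideanSpace ℝ (Fin 2)) R).indicator (fun z => ‖z‖⁻¹) z =
      2 * volume.real (Metric.ball (0 : EuclideanSpace ℝ (Fin 2)) 1) * R := by
  have h := integral_fun_norm_addHaar (volume : Measure (EuclideanSpace ℝ (Fin 2)))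
    ((Iio R).indicator fun r : ℝ => r⁻¹)
  have h1 : (fun z : EuclideanSpace ℝ (Fin 2) => (Iio R).indicator (fun r : ℝ => r⁻¹) ‖z‖) =
      (Metric.ball (0 : EuclideanSpace ℝ (Fin 2)) R).indicator (fun z => ‖z‖⁻¹) := by
    ext z
    simp [indicator]
  rw [h1] at h
  rw [h]
  have h2 : ∫ y in Ioi (0 : ℝ), y ^ (Module.finrank ℝ (EuclideanSpace ℝ (Fin 2)) - 1) •
      (Iio R).indicator (fun r : ℝ => r⁻¹) y = ∫ y in Ioi (0 : ℝ), (Iio R).indicator 1 y := by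
    refine setIntegral_congr_fun measurableSet_Ioi fun y hy => ?_
    have : y ≠ 0 := ne_of_gt hy
    by_cases hyR : y < R <;> simp [hyR, this]
  rw [h2, setIntegral_indicator measurableSet_Iio, Ioi_inter_Iio]
  simp [hR]
  ring

theorem norm_perp (z : EuclideanSpace ℝ (Fin 2)) : ‖perp z‖ = ‖z‖ := by
  simp [perp, EuclideanSpace.norm_eq, add_comm]

/-- A linear-growth bound for the Biot–Savart velocity of a bounded, compactly supported
vorticity. -/
theorem exists_norm_biotSavart_le : ∃ C : ℝ, 0 ≤ C ∧
    ∀ (ω : EuclideanSpace ℝ (Fin 2) → ℝ) (M R : ℝ), 0 < R → (∀ y, |ω y| ≤ M) →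
      (∀ y, R < ‖y‖ → ω y = 0) → ∀ x, ‖biotSavart ω x‖ ≤ C * M * R := by
  set c := volume.real (Metric.ball (0 : EuclideanSpace ℝ (Fin 2)) 1) with hc
  have hc0 : 0 ≤ c := measureReal_nonneg
  refine ⟨3 * c, by positivity, fun ω M R hR hM hsupp x => ?_⟩
  have hM0 : 0 ≤ M := (abs_nonneg _).trans (hM 0)
  set k : EuclideanSpace ℝ (Fin 2) → ℝ :=
    (Metric.ball (0 : EuclideanSpace ℝ (Fin 2)) R).indicator fun z => ‖z‖⁻¹ with hk
  have hki : Integrable k := integrable_indicator_ball_inv_norm R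
  have hki' : Integrable fun y => k (x - y) := hki.comp_sub_left x
  set l : EuclideanSpace ℝ (Fin 2) → ℝ :=
    (Metric.closedBall (0 : EuclideanSpace ℝ (Fin 2)) R).indicator fun _ => R⁻¹ with hl
  have hli : Integrable l := by
    rw [hl, integrable_indicator_iff Metric.isClosed_closedBall.measurableSet]
    exact integrableOn_const (isCompact_closedBall _ _).measure_lt_top.ne
  have hl1 : ∫ y, l y = c * R := by
    rw [hl, integral_indicator Metric.isClosed_closedBall.measurableSet, setIntegral_const,
      Measure.real, Measure.addHaar_closedBall _ _ hR.le, ENNReal.toReal_mul,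
      ENNReal.toReal_ofReal (by positivity), ← Measure.real, ← hc]
    simp
    field_simp
  have hb : ∀ y, ‖(ω y / ‖x - y‖ ^ 2) • perp (x - y)‖ ≤ M * (k (x - y) + l y) := by
    intro y
    have hk0 : 0 ≤ k (x - y) := indicator_nonneg (fun z _ => by positivity) _
    have hl0 : 0 ≤ l y := indicator_nonneg (fun z _ => by positivity) _
    rw [norm_smul, norm_perp, norm_div, norm_pow, norm_norm, Real.norm_eq_abs]
    by_cases hy : R < ‖y‖
    · rw [hsupp y hy]
      simp only [abs_zero, zero_div, zero_mul]
      positivity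
    have e : |ω y| / ‖x - y‖ ^ 2 * ‖x - y‖ = |ω y| * ‖x - y‖⁻¹ := by
      by_cases h0 : ‖x - y‖ = 0
      · simp [h0]
      · field_simp
    rw [e]
    refine mul_le_mul (hM y) ?_ (by positivity) hM0
    by_cases hxy : ‖x - y‖ < R
    · have : k (x - y) = ‖x - y‖⁻¹ := by simp [hk, hxy]
      linarith
    · have : l y = R⁻¹ := by simp [hl, not_lt.1 hy]
      have h2 : ‖x - y‖⁻¹ ≤ R⁻¹ := inv_anti₀ hR (not_lt.1 hxy)
      linarith
  have h1 := norm_integral_le_of_norm_le ((hki'.add hli).const_mul M)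
    (Filter.Eventually.of_forall hb)
  have h2 : ∫ y, M * (k (x - y) + l y) = M * (3 * c * R) := by
    rw [integral_const_mul, integral_add hki' hli, hl1, integral_sub_left_eq_self k,
      hk, integral_indicator_ball_inv_norm hR.le]
    ring
  rw [biotSavart, norm_smul]
  have h3 : ‖1 / (2 * π)‖ ≤ 1 := by
    rw [Real.norm_of_nonneg (by positivity), div_le_one (by positivity)]
    linarith [Real.pi_gt_three]
  calc _ ≤ 1 * (M * (3 * c * R)) := by
        refine mul_le_mul h3 (h1.trans_eq h2) (norm_nonneg _) zero_le_one
    _ = _ := by ring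

section UniformSupport

variable {E : Type*} [NormedAddCommGroup E] [NormedSpace ℝ E] [ProperSpace E]
  {f : ℝ → E → ℝ} {T C : ℝ}

/-- `f` solves a transport equation on `[0, T]` whose velocity grows at most linearly with
the size of the support and of the values of `f`. -/
def IsSelfTransported (f : ℝ → E → ℝ) (T C : ℝ) : Prop :=
  ∀ t ∈ Icc (0 : ℝ) T, ∀ M R, 0 < R → (∀ y, |f t y| ≤ M) → (∀ y, R < ‖y‖ → f t y = 0) →
    ∀ x, ∃ v, ‖v‖ ≤ C * M * R ∧ deriv (fun s => f s x) t = fderiv ℝ (f t) x v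

theorem exists_abs_le_of_support (hf : Differentiable ℝ fun p : ℝ × E => f p.1 p.2)
    {K : Set ℝ} (hK : IsCompact K) (R : ℝ) :
    ∃ M, 0 ≤ M ∧ ∀ t ∈ K, (∀ x, R < ‖x‖ → f t x = 0) → ∀ x, |f t x| ≤ M := by
  obtain ⟨M, hM⟩ := (hK.prod (isCompact_closedBall (0 : E) R)).exists_bound_of_continuousOn
    hf.continuous.continuousOn
  refine ⟨max M 0, le_max_right _ _, fun t ht hs x => ?_⟩
  by_cases hx : R < ‖x‖
  · simp [hs x hx]
  · exact (hM (t, x) ⟨ht, by simpa using hx⟩).trans (le_max_left _ _)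

/-- Over a short time the supremum norm does not increase and the support radius at most
doubles, as soon as the supports are uniformly bounded. -/
theorem IsSelfTransported.support_doubling (H : IsSelfTransported f T C) (hC : 0 ≤ C)
    (hf : Differentiable ℝ fun p : ℝ × E => f p.1 p.2) {a b : ℝ}
    (hab : uIcc a b ⊆ Icc 0 T) {ρ : ℝ} (hρ : ∀ t ∈ uIcc a b, ∀ x, ρ < ‖x‖ → f t x = 0)
    {M : ℝ} (hM : ∀ x, |f a x| ≤ M) :
    (∀ t ∈ uIcc a b, ∀ x, |f t x| ≤ M) ∧
    ∀ R, 0 < R → (∀ x, R < ‖x‖ → f a x = 0) → C * M * |b - a| ≤ 1 / 2 →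
      ∀ t ∈ uIcc a b, ∀ x, 2 * R < ‖x‖ → f t x = 0 := by
  have hM0 : 0 ≤ M := (abs_nonneg _).trans (hM 0)
  have hsub : ∀ t ∈ uIcc a b, uIcc a t ⊆ uIcc a b := fun t ht =>
    uIcc_subset_uIcc left_mem_uIcc ht
  have hle : ∀ t ∈ uIcc a b, |t - a| ≤ |b - a| := fun t ht => abs_sub_left_of_mem_uIcc ht
  have h1 : ∀ t ∈ uIcc a b, ∀ x, |f t x| ≤ M := by
    obtain ⟨M', hM'0, hM'⟩ := exists_abs_le_of_support hf (isCompact_uIcc (a := a) (b := b)) ρ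
    have hpos : 0 < max ρ 1 := lt_max_of_lt_right one_pos
    intro t ht x
    refine transport_abs_le (V := C * M' * max ρ 1) hf (by positivity) (fun s hs y => ?_)
      fun y _ => hM y
    have hs' := hsub t ht hs
    exact H s (hab hs') M' _ hpos (hM' s hs' (hρ s hs'))
      (fun z hz => hρ s hs' z ((le_max_left _ _).trans_lt hz)) y
  refine ⟨h1, fun R hR hsupp hshort => ?_⟩
  have step : ∀ δ, 0 < δ → (∀ t ∈ uIcc a b, ∀ x, δ < ‖x‖ → f t x = 0) →
      ∀ t ∈ uIcc a b, ∀ x, R + δ / 2 < ‖x‖ → f t x = 0 := by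
    intro δ hδ hv t ht x hx
    rw [← abs_nonpos_iff]
    refine transport_abs_le (a := a) (V := C * M * δ) hf (by positivity) (fun s hs y => ?_)
      fun y hy => ?_
    · exact H s (hab (hsub t ht hs)) M δ hδ (h1 s (hsub t ht hs)) (hv s (hsub t ht hs)) y
    · rw [hsupp y, abs_zero]
      rw [mem_closedBall_iff_norm] at hy
      have h2 : C * M * δ * |t - a| ≤ δ / 2 := by
        have : C * M * |t - a| ≤ 1 / 2 :=
          (mul_le_mul_of_nonneg_left (hle t ht) (by positivity)).trans hshort
        nlinarith
      have h3 := norm_sub_norm_le x y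
      rw [norm_sub_rev] at h3
      linarith
  have iter : ∀ k : ℕ, ∀ t ∈ uIcc a b, ∀ x, 2 * R + max ρ 0 / 2 ^ k < ‖x‖ → f t x = 0 := by
    intro k
    induction k with
    | zero =>
      intro t ht x hx
      refine hρ t ht x ?_
      have := le_max_left ρ 0
      simp only [pow_zero, div_one] at hx
      linarith
    | succ k ih =>
      intro t ht x hx
      refine step _ (by positivity) ih t ht x ?_
      rw [pow_succ, ← div_div] at hx
      linarith
  intro t ht x hx
  have hlim : Filter.Tendsto (fun k : ℕ => 2 * R + max ρ 0 / 2 ^ k) Filter.atTop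
      (nhds (2 * R + 0)) :=
    (tendsto_const_nhds.div_atTop (tendsto_pow_atTop_atTop_of_one_lt _root_.one_lt_two)).const_add _
  rw [add_zero] at hlim
  obtain ⟨k, hk⟩ := (hlim.eventually (gt_mem_nhds hx)).exists
  exact iter k t ht x hk

/-- The slices of a jointly smooth self-transported function with compactly supported slices
have uniformly bounded support. -/
theorem IsSelfTransported.exists_uniform_support (H : IsSelfTransported f T C) (hC : 0 ≤ C)
    (hf : Differentiable ℝ fun p : ℝ × E => f p.1 p.2) (hcs : ∀ t, HasCompactSupport (f t)) :
    ∃ R, ∀ t ∈ Icc (0 : ℝ) T, ∀ x, R < ‖x‖ → f t x = 0 := by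
  have hcx : ∀ x, Continuous fun t => f t x := fun x =>
    hf.continuous.comp (f := fun t => (t, x)) (by fun_prop)
  let good : Set ℝ → Prop := fun S => ∃ R, ∀ t ∈ S, t ∈ Icc (0 : ℝ) T → ∀ x, R < ‖x‖ → f t x = 0
  have compact_good : ∀ K : Set ℝ, IsCompact K →
      (∀ t ∈ K, ∃ U ∈ nhdsWithin t K, good U) → good K := by
    intro K hK hloc
    refine hK.induction_on (p := good) ⟨0, by simp⟩ ?_ ?_ hloc
    · rintro s t hst ⟨R, hR⟩
      exact ⟨R, fun τ hτ => hR τ (hst hτ)⟩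
    · rintro s t ⟨R, hR⟩ ⟨R', hR'⟩
      refine ⟨max R R', fun τ hτ hτT x hx => ?_⟩
      rcases hτ with hτ | hτ
      · exact hR τ hτ hτT x ((le_max_left _ _).trans_lt hx)
      · exact hR' τ hτ hτT x ((le_max_right _ _).trans_lt hx)
  let P : Set ℝ := {t | t ∈ Icc (0 : ℝ) T ∧ ∀ U ∈ nhds t, ¬ good U}
  suffices hP : P = ∅ by
    obtain ⟨R, hR⟩ := compact_good (Icc 0 T) isCompact_Icc fun t ht => by
      have : t ∉ P := by simp [hP]
      simp only [P, mem_ofPred_eq, not_and, not_forall, not_not] at this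
      obtain ⟨U, hU, hg⟩ := this ht
      exact ⟨U, mem_nhdsWithin_of_mem_nhds hU, hg⟩
    exact ⟨R, fun t ht => hR t ht ht⟩
  have hPT : P ⊆ Icc 0 T := fun t ht => ht.1
  have hnotP : ∀ t ∈ Icc (0 : ℝ) T, t ∉ P → ∃ U ∈ nhds t, good U := by
    intro t ht h
    simp only [P, mem_ofPred_eq, not_and, not_forall, not_not] at h
    obtain ⟨U, hU, hg⟩ := h ht
    exact ⟨U, hU, hg⟩
  have hPc : IsClosed P := by
    have hPc' : IsClosed {t : ℝ | ∀ U ∈ nhds t, ¬ good U} := by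
      rw [← isOpen_compl_iff, isOpen_iff_mem_nhds]
      intro t ht
      simp only [mem_compl_iff, mem_ofPred_eq, not_forall, not_not] at ht
      obtain ⟨U, hU, hg⟩ := ht
      filter_upwards [eventually_mem_nhds_iff.2 hU] with s hs
      simp only [mem_compl_iff, mem_ofPred_eq, not_forall, not_not]
      exact ⟨U, hs, hg⟩
    exact isClosed_Icc.inter hPc'
  by_contra hne
  obtain ⟨p₀, hp₀⟩ := nonempty_iff_ne_empty.2 hne
  have : Nonempty P := ⟨⟨p₀, hp₀⟩⟩
  have : CompleteSpace P := hPc.completeSpace_coe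
  obtain ⟨n, hn⟩ := nonempty_interior_of_iUnion_of_closed
    (f := fun n : ℕ => {t : P | ∀ x, (n : ℝ) < ‖x‖ → f t x = 0}) (fun n => by
      simp only [ofPred_forall]
      exact isClosed_iInter fun x => isClosed_iInter fun _ =>
        isClosed_eq ((hcx x).comp continuous_subtype_val) continuous_const) (by
      refine eq_univ_of_forall fun t => mem_iUnion.2 ?_
      obtain ⟨R, hR⟩ := (hcs t).isCompact.isBounded.subset_closedBall 0
      obtain ⟨n, hn⟩ := exists_nat_gt R
      refine ⟨n, fun x hx => ?_⟩
      by_contra h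
      have := hR (subset_tsupport _ h)
      rw [mem_closedBall_zero_iff] at this
      linarith)
  obtain ⟨c, hc⟩ := hn
  obtain ⟨δ, hδ, hball⟩ := Metric.mem_nhds_iff.1 (mem_interior_iff_mem_nhds.1 hc)
  have hPn : ∀ t ∈ P, |t - c| < δ → ∀ x, (n : ℝ) + 1 < ‖x‖ → f t x = 0 := fun t ht htc x hx =>
    hball (show (⟨t, ht⟩ : P) ∈ Metric.ball c δ from htc) x (by linarith)
  obtain ⟨M, hM0, hM⟩ := exists_abs_le_of_support hf (isCompact_Icc (a := (0 : ℝ)) (b := T)) (n + 1)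
  set η := min δ (1 / (2 * (C * M + 1))) with hη
  have hη0 : 0 < η := lt_min hδ (by positivity)
  have hηM : ∀ r, r ≤ η → C * M * r ≤ 1 / 2 := by
    intro r hr
    calc C * M * r ≤ C * M * (1 / (2 * (C * M + 1))) :=
          mul_le_mul_of_nonneg_left (hr.trans (min_le_right _ _)) (by positivity)
      _ ≤ 1 / 2 := by
          have : 0 ≤ C * M := by positivity
          rw [mul_one_div, div_le_iff₀ (by positivity)]
          linarith
  refine c.2.2 (Metric.ball c η) (Metric.ball_mem_nhds _ hη0) ⟨2 * (n + 1), fun t htc htT => ?_⟩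
  rw [Metric.mem_ball, Real.dist_eq] at htc
  -- the point of `P` between `t` and `c` closest to `t`
  obtain ⟨b, ⟨hbP, hbu⟩, hbmin⟩ := ((isCompact_uIcc (a := t) (b := c)).inter_left hPc).exists_isMinOn
    ⟨c, c.2, right_mem_uIcc⟩ (continuous_id.sub continuous_const).abs.continuousOn
    (f := fun s => |s - t|)
  have hbT := hPT hbP
  have hbc : |b - c| < δ := by
    rw [abs_sub_comm]
    refine (abs_sub_right_of_mem_uIcc hbu).trans_lt ?_
    rw [abs_sub_comm]
    exact htc.trans_le (min_le_left _ _)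
  have hbt : |b - t| < η := by
    refine (abs_sub_left_of_mem_uIcc hbu).trans_lt ?_
    rwa [abs_sub_comm]
  have hsub : uIcc t b ⊆ Icc 0 T := uIcc_subset_Icc htT hbT
  have hbn := hPn b hbP hbc
  have hbM : ∀ x, |f b x| ≤ M := hM b hbT hbn
  have huniform : ∃ ρ, ∀ s ∈ uIcc b t, ∀ x, ρ < ‖x‖ → f s x = 0 := by
    rcases eq_or_ne t b with rfl | htb
    · refine ⟨n + 1, fun s hs => ?_⟩
      rw [uIcc_self, mem_singleton_iff] at hs
      rwa [hs]
    have hinner : ∀ s ∈ uIcc t b, s ≠ b → ∃ ρ, ∀ τ ∈ uIcc t s, ∀ x, ρ < ‖x‖ → f τ x = 0 := by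
      intro s hs hsb
      obtain ⟨ρ, hρ⟩ := compact_good (uIcc t s) isCompact_uIcc fun τ hτ => by
        have hτb : τ ∈ uIcc t b := uIcc_subset_uIcc left_mem_uIcc hs hτ
        have hτP : τ ∉ P := fun hτP => by
          have h1 : |b - t| ≤ |τ - t| := hbmin ⟨hτP, uIcc_subset_uIcc left_mem_uIcc hbu hτb⟩
          have h2 : |τ - t| ≤ |s - t| := abs_sub_left_of_mem_uIcc hτ
          have h3 : |s - t| < |b - t| := by
            rcases le_total t b with h | h
            · rw [uIcc_of_le h] at hs
              rw [abs_of_nonneg (by linarith [hs.1]), abs_of_nonneg (by linarith)]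
              linarith [lt_of_le_of_ne hs.2 hsb]
            · rw [uIcc_of_ge h] at hs
              rw [abs_of_nonpos (by linarith [hs.2]), abs_of_nonpos (by linarith)]
              linarith [lt_of_le_of_ne hs.1 (Ne.symm hsb)]
          linarith
        obtain ⟨U, hU, hg⟩ := hnotP τ (hsub hτb) hτP
        exact ⟨U, mem_nhdsWithin_of_mem_nhds hU, hg⟩
      exact ⟨ρ, fun τ hτ => hρ τ hτ (hsub (uIcc_subset_uIcc left_mem_uIcc hs hτ))⟩
    obtain ⟨M', hM'⟩ : ∃ M', ∀ x, |f t x| ≤ M' := by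
      obtain ⟨M', hM'⟩ := (hcs t).exists_bound_of_continuous
        (hf.continuous.comp (f := fun x => (t, x)) (by fun_prop))
      exact ⟨M', hM'⟩
    have hM'0 : 0 ≤ M' := (abs_nonneg _).trans (hM' 0)
    set θ : ℝ := min 1 (1 / (2 * (C * M' * |b - t| + 1))) with hθ
    have hθ0 : 0 < θ := lt_min one_pos (by positivity)
    set s₀ := b + θ * (t - b) with hs₀
    have hs₀mem : s₀ ∈ uIcc t b := by
      have : θ ≤ 1 := min_le_left _ _
      rcases le_total t b with h | h
      · rw [uIcc_of_le h]; constructor <;> nlinarith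
      · rw [uIcc_of_ge h]; constructor <;> nlinarith
    have hs₀b : s₀ ≠ b := by
      have : θ * (t - b) ≠ 0 := mul_ne_zero hθ0.ne' (sub_ne_zero.2 htb)
      simpa [hs₀] using this
    have hshort : C * M' * |b - s₀| ≤ 1 / 2 := by
      have e : |b - s₀| = θ * |b - t| := by
        have : b - s₀ = θ * (b - t) := by rw [hs₀]; ring
        rw [this, abs_mul, abs_of_pos hθ0]
      have h0 : 0 ≤ C * M' * |b - t| := by positivity
      rw [e]
      calc C * M' * (θ * |b - t|) = C * M' * |b - t| * θ := by ring
        _ ≤ C * M' * |b - t| * (1 / (2 * (C * M' * |b - t| + 1))) :=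
            mul_le_mul_of_nonneg_left (min_le_right _ _) h0
        _ ≤ 1 / 2 := by
            rw [mul_one_div, div_le_iff₀ (by positivity)]
            linarith
    obtain ⟨ρ₀, hρ₀⟩ := hinner s₀ hs₀mem hs₀b
    have hs₀M : ∀ x, |f s₀ x| ≤ M' :=
      (H.support_doubling hC hf ((uIcc_subset_uIcc left_mem_uIcc hs₀mem).trans hsub) hρ₀ hM').1
        s₀ right_mem_uIcc
    have hr0 : 0 < max ρ₀ 1 := lt_max_of_lt_right one_pos
    have hlate : ∀ s ∈ uIcc s₀ b, s ≠ b → ∀ x, 2 * max ρ₀ 1 < ‖x‖ → f s x = 0 := by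
      intro s hs hsb
      have hs' : s ∈ uIcc t b := uIcc_subset_uIcc hs₀mem right_mem_uIcc hs
      have hs₀s : uIcc s₀ s ⊆ uIcc t b := uIcc_subset_uIcc hs₀mem hs'
      obtain ⟨ρ, hρ⟩ := hinner s hs' hsb
      have hs₀ts : s₀ ∈ uIcc t s := by
        rcases le_total t b with h | h
        · have h4 : s₀ ≤ b := by rw [uIcc_of_le h] at hs₀mem; exact hs₀mem.2
          rw [uIcc_of_le h] at hs₀mem hs'
          rw [uIcc_of_le h4] at hs
          rw [uIcc_of_le hs'.1]
          exact ⟨hs₀mem.1, hs.1⟩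
        · have h4 : b ≤ s₀ := by rw [uIcc_of_ge h] at hs₀mem; exact hs₀mem.1
          rw [uIcc_of_ge h] at hs₀mem hs'
          rw [uIcc_of_ge h4] at hs
          rw [uIcc_of_ge hs'.2]
          exact ⟨hs.2, hs₀mem.2⟩
      refine (H.support_doubling hC hf (hs₀s.trans hsub)
        (fun τ hτ => hρ τ (uIcc_subset_uIcc hs₀ts right_mem_uIcc hτ)) hs₀M).2 _ hr0
        (fun x hx => hρ₀ s₀ right_mem_uIcc x ((le_max_left _ _).trans_lt hx)) ?_ s right_mem_uIcc
      refine (mul_le_mul_of_nonneg_left ?_ (by positivity)).trans hshort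
      exact abs_sub_left_of_mem_uIcc hs
    refine ⟨max (2 * max ρ₀ 1) (n + 1), fun s hs x hx => ?_⟩
    have hx1 := (le_max_left _ _).trans_lt hx
    have hx2 := (le_max_right _ _).trans_lt hx
    rcases eq_or_ne s b with rfl | hsb
    · exact hbn x hx2
    rcases uIcc_subset_uIcc_union_uIcc (b := s₀) hs with h | h
    · rw [uIcc_comm] at h
      exact hlate s h hsb x hx1
    · rw [uIcc_comm] at h
      refine hρ₀ s h x ?_
      have := le_max_left ρ₀ 1
      linarith
  obtain ⟨ρ, hρ⟩ := huniform
  refine (H.support_doubling hC hf (by rwa [uIcc_comm]) hρ hbM).2 _ (by positivity) hbn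
    (hηM _ ?_) t right_mem_uIcc
  rw [abs_sub_comm]
  exact hbt.le

end UniformSupport

theorem isOpen_Quadrant : IsOpen Quadrant :=
  (isOpen_lt continuous_const (g := fun x : EuclideanSpace ℝ (Fin 2) => x 0) (by fun_prop)).inter
    (isOpen_lt continuous_const (g := fun x : EuclideanSpace ℝ (Fin 2) => x 1) (by fun_prop))

theorem measurableSet_Quadrant : MeasurableSet Quadrant := isOpen_Quadrant.measurableSet

/-- Bounded measurable functions vanishing outside a ball. -/
def IsBddWithBddSupport (w : EuclideanSpace ℝ (Fin 2) → ℝ) : Prop :=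
  Measurable w ∧ (∃ B, ∀ x, |w x| ≤ B) ∧ ∃ R, ∀ x, R < ‖x‖ → w x = 0

namespace IsBddWithBddSupport

variable {w q : EuclideanSpace ℝ (Fin 2) → ℝ}

theorem of_continuous (hw : Continuous w) {R : ℝ} (hR : ∀ x, R < ‖x‖ → w x = 0) :
    IsBddWithBddSupport w := by
  refine ⟨hw.measurable, ?_, R, hR⟩
  obtain ⟨B, hB⟩ := (isCompact_closedBall (0 : EuclideanSpace ℝ (Fin 2))
    R).exists_bound_of_continuousOn hw.continuousOn
  refine ⟨max B 0, fun x => ?_⟩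
  by_cases hx : R < ‖x‖
  · simp [hR x hx]
  · exact (hB x (by simpa using hx)).trans (le_max_left _ _)

theorem indicator (hw : IsBddWithBddSupport w) {S : Set (EuclideanSpace ℝ (Fin 2))}
    (hS : MeasurableSet S) : IsBddWithBddSupport (S.indicator w) := by
  obtain ⟨hm, ⟨B, hB⟩, R, hR⟩ := hw
  refine ⟨hm.indicator hS, ⟨B, fun x => ?_⟩, R, fun x hx => ?_⟩
  · by_cases hx : x ∈ S
    · simpa [hx] using hB x
    · simpa [hx] using (abs_nonneg _).trans (hB x)
  · by_cases hxS : x ∈ S <;> simp [hxS, hR x hx]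

theorem comp_isometry (hw : IsBddWithBddSupport w)
    (e : EuclideanSpace ℝ (Fin 2) ≃ₗᵢ[ℝ] EuclideanSpace ℝ (Fin 2)) :
    IsBddWithBddSupport fun x => w (e x) := by
  obtain ⟨hm, ⟨B, hB⟩, R, hR⟩ := hw
  exact ⟨hm.comp e.continuous.measurable, ⟨B, fun x => hB _⟩, R,
    fun x hx => hR _ (by simpa using hx)⟩

theorem integrable (hw : IsBddWithBddSupport w) : Integrable w := by
  obtain ⟨hm, ⟨B, hB⟩, R, hR⟩ := hw
  have : Integrable ((Metric.closedBall (0 : EuclideanSpace ℝ (Fin 2)) R).indicator fun _ => B) := by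
    rw [integrable_indicator_iff Metric.isClosed_closedBall.measurableSet]
    exact integrableOn_const (isCompact_closedBall _ _).measure_lt_top.ne
  refine this.mono' hm.aestronglyMeasurable (Filter.Eventually.of_forall fun x => ?_)
  by_cases hx : R < ‖x‖
  · simp [hR x hx, hx]
  · simpa [not_lt.1 hx] using hB x

/-- Kernels with a `‖z‖⁻¹` singularity are integrable against products. -/
theorem integrable_prod (hw : IsBddWithBddSupport w) (hq : IsBddWithBddSupport q)
    {k : EuclideanSpace ℝ (Fin 2) → ℝ} (hkm : Measurable k) (hk : ∀ z, |k z| ≤ ‖z‖⁻¹) :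
    Integrable (fun z : EuclideanSpace ℝ (Fin 2) × EuclideanSpace ℝ (Fin 2) =>
      k (z.1 - z.2) * w z.1 * q z.2) (volume.prod volume) := by
  have hqi := hq.integrable
  obtain ⟨hm, ⟨B, hB⟩, R, hR⟩ := hw
  obtain ⟨hm', -, R', hR'⟩ := hq
  have hB0 : 0 ≤ B := (abs_nonneg _).trans (hB 0)
  have h := (hqi.norm.convolution_integrand (ContinuousLinearMap.mul ℝ ℝ)
    (integrable_indicator_ball_inv_norm (R + R' + 1))).const_mul B
  refine h.mono' (((hkm.comp (measurable_fst.sub measurable_snd)).mul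
    (hm.comp measurable_fst)).mul (hm'.comp measurable_snd)).aestronglyMeasurable
    (Filter.Eventually.of_forall fun ⟨x, y⟩ => ?_)
  simp only [ContinuousLinearMap.mul_apply', Real.norm_eq_abs, abs_mul]
  by_cases hx : R < ‖x‖
  · rw [hR x hx]
    simp only [abs_zero, mul_zero, zero_mul]
    exact mul_nonneg hB0 (mul_nonneg (abs_nonneg _)
      (indicator_nonneg (fun z _ => by positivity) _))
  by_cases hy : R' < ‖y‖
  · simp [hR' y hy]
  have hxy : x - y ∈ Metric.ball (0 : EuclideanSpace ℝ (Fin 2)) (R + R' + 1) := by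
    rw [mem_ball_zero_iff]
    linarith [norm_sub_le x y]
  rw [indicator_of_mem hxy]
  calc |k (x - y)| * |w x| * |q y| ≤ ‖x - y‖⁻¹ * B * |q y| := by
        gcongr
        · exact hk _
        · exact hB _
    _ = _ := by ring

theorem integrable_kernel_mul (hw : IsBddWithBddSupport w)
    {k : EuclideanSpace ℝ (Fin 2) → ℝ} (hkm : Measurable k) (hk : ∀ z, |k z| ≤ ‖z‖⁻¹)
    (y : EuclideanSpace ℝ (Fin 2)) : Integrable fun x => k (x - y) * w x := by
  obtain ⟨hm, ⟨B, hB⟩, R, hR⟩ := hw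
  have hB0 : 0 ≤ B := (abs_nonneg _).trans (hB 0)
  have h := ((integrable_indicator_ball_inv_norm (R + ‖y‖ + 1)).comp_sub_right y).const_mul B
  refine h.mono' ((hkm.comp (measurable_id.sub_const y)).mul hm).aestronglyMeasurable
    (Filter.Eventually.of_forall fun x => ?_)
  rw [Real.norm_eq_abs, abs_mul]
  by_cases hx : R < ‖x‖
  · rw [hR x hx]
    simp only [abs_zero, mul_zero]
    exact mul_nonneg hB0 (indicator_nonneg (fun z _ => by positivity) _)
  have hxy : x - y ∈ Metric.ball (0 : EuclideanSpace ℝ (Fin 2)) (R + ‖y‖ + 1) := by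
    rw [mem_ball_zero_iff]
    linarith [norm_sub_le x y]
  rw [indicator_of_mem hxy, mul_comm B]
  gcongr
  · exact hk _
  · exact hB _

end IsBddWithBddSupport

/-- The kernels `zᵢ / |z|²`, which up to sign and order are the components of the
Biot–Savart kernel. -/
def bsKernel (i : Fin 2) (z : EuclideanSpace ℝ (Fin 2)) : ℝ := z i / ‖z‖ ^ 2

theorem measurable_bsKernel (i : Fin 2) : Measurable (bsKernel i) := by
  unfold bsKernel
  fun_prop

theorem abs_bsKernel_le (i : Fin 2) (z : EuclideanSpace ℝ (Fin 2)) : |bsKernel i z| ≤ ‖z‖⁻¹ := by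
  rw [bsKernel, abs_div, abs_pow, abs_norm]
  by_cases h0 : ‖z‖ = 0
  · simp [h0]
  have : |z i| ≤ ‖z‖ := PiLp.norm_apply_le z i
  have h1 : 0 < ‖z‖ := lt_of_le_of_ne (norm_nonneg _) (Ne.symm h0)
  rw [div_le_iff₀ (by positivity)]
  field_simp
  exact this

theorem perp_eq (z : EuclideanSpace ℝ (Fin 2)) : perp z =
    z 0 • EuclideanSpace.single 1 (1 : ℝ) - z 1 • EuclideanSpace.single 0 (1 : ℝ) := by
  ext i
  fin_cases i <;> simp [perp]

theorem continuous_perp : Continuous perp := by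
  rw [funext perp_eq]
  fun_prop

theorem map_perp (L : EuclideanSpace ℝ (Fin 2) →L[ℝ] ℝ) (z : EuclideanSpace ℝ (Fin 2)) :
    L (perp z) = z 0 * L (EuclideanSpace.single 1 1) - z 1 * L (EuclideanSpace.single 0 1) := by
  rw [perp_eq, map_sub, map_smul, map_smul, smul_eq_mul, smul_eq_mul]

theorem map_perp_div (L : EuclideanSpace ℝ (Fin 2) →L[ℝ] ℝ) (z : EuclideanSpace ℝ (Fin 2)) :
    L (perp z) / ‖z‖ ^ 2 = bsKernel 0 z * L (EuclideanSpace.single 1 1) -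
      bsKernel 1 z * L (EuclideanSpace.single 0 1) := by
  rw [map_perp, bsKernel, bsKernel]
  ring

theorem inner_perp_self (z : EuclideanSpace ℝ (Fin 2)) : inner ℝ z (perp z) = 0 := by
  simp [perp, PiLp.inner_apply]
  ring

/-- Coordinates on the Euclidean plane. -/
def planeEquiv : (ℝ × ℝ) ≃L[ℝ] EuclideanSpace ℝ (Fin 2) :=
  (ContinuousLinearEquiv.finTwoArrow ℝ ℝ).symm.trans (EuclideanSpace.equiv (Fin 2) ℝ).symm

@[simp] theorem planeEquiv_zero (p : ℝ × ℝ) : planeEquiv p 0 = p.1 := rfl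

@[simp] theorem planeEquiv_one (p : ℝ × ℝ) : planeEquiv p 1 = p.2 := rfl

theorem measurePreserving_planeEquiv : MeasurePreserving planeEquiv :=
  (PiLp.volume_preserving_toLp (Fin 2)).comp ((volume_preserving_finTwoArrow ℝ).symm _)

theorem setIntegral_Quadrant_eq {G : EuclideanSpace ℝ (Fin 2) → ℝ} {R : ℝ}
    (hG : ∀ x, R < ‖x‖ → G x = 0) :
    ∫ x in Quadrant, G x = ∫ p in Icc ((0 : ℝ), (0 : ℝ)) (R, R), G (planeEquiv p) := by
  have h1 := measurePreserving_planeEquiv.setIntegral_preimage_emb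
    planeEquiv.toHomeomorph.measurableEmbedding G Quadrant
  have h2 : planeEquiv ⁻¹' Quadrant = Ioi (0 : ℝ) ×ˢ Ioi (0 : ℝ) := rfl
  have h3 : (Ioi (0 : ℝ) ×ˢ Ioi (0 : ℝ) : Set (ℝ × ℝ)) =ᵐ[volume] Ici (0 : ℝ) ×ˢ Ici (0 : ℝ) :=
    Measure.set_prod_ae_eq Ioi_ae_eq_Ici Ioi_ae_eq_Ici
  rw [← h1, h2, setIntegral_congr_set h3]
  refine setIntegral_eq_of_subset_of_forall_sdiff_eq_zero
    (measurableSet_Ici.prod measurableSet_Ici) (fun p hp => ⟨hp.1.1, hp.1.2⟩) fun p hp => ?_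
  refine hG _ ?_
  by_contra! h
  have h4 : |p.1| ≤ R := (PiLp.norm_apply_le (planeEquiv p) 0).trans h
  have h5 : |p.2| ≤ R := (PiLp.norm_apply_le (planeEquiv p) 1).trans h
  exact hp.2 ⟨⟨hp.1.1, hp.1.2⟩, ⟨(le_abs_self _).trans h4, (le_abs_self _).trans h5⟩⟩

/-- Rotational derivatives of functions vanishing on the boundary of a square have mean zero. -/
theorem integral_fderiv_rotation_eq_zero {ψ : ℝ × ℝ → ℝ} (hψ : ContDiff ℝ 1 ψ) {R : ℝ}
    (hR : 0 ≤ R) (c : ℝ × ℝ) (h₁ : ∀ y, ψ (0, y) = 0) (h₂ : ∀ y, ψ (R, y) = 0)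
    (h₃ : ∀ x, ψ (x, 0) = 0) (h₄ : ∀ x, ψ (x, R) = 0) :
    ∫ p in Icc ((0 : ℝ), (0 : ℝ)) (R, R), fderiv ℝ ψ p (-(p.2 - c.2), p.1 - c.1) = 0 := by
  have hd : ∀ p, HasFDerivAt ψ (fderiv ℝ ψ p) p := fun p =>
    (hψ.differentiable (by simp) p).hasFDerivAt
  have hdc : Continuous (fderiv ℝ ψ) := hψ.continuous_fderiv (by simp)
  have hf : ∀ p : ℝ × ℝ, HasFDerivAt (fun p : ℝ × ℝ => -(p.2 - c.2) * ψ p)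
      (-(p.2 - c.2) • fderiv ℝ ψ p + ψ p • -ContinuousLinearMap.snd ℝ ℝ ℝ) p := fun p =>
    ((hasFDerivAt_snd.sub_const c.2).neg).mul (hd p)
  have hg : ∀ p : ℝ × ℝ, HasFDerivAt (fun p : ℝ × ℝ => (p.1 - c.1) * ψ p)
      ((p.1 - c.1) • fderiv ℝ ψ p + ψ p • ContinuousLinearMap.fst ℝ ℝ ℝ) p := fun p =>
    (hasFDerivAt_fst.sub_const c.1).mul (hd p)
  have hsum : ∀ p : ℝ × ℝ, fderiv ℝ ψ p (-(p.2 - c.2), p.1 - c.1) =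
      (-(p.2 - c.2) • fderiv ℝ ψ p + ψ p • -ContinuousLinearMap.snd ℝ ℝ ℝ) (1, 0) +
      ((p.1 - c.1) • fderiv ℝ ψ p + ψ p • ContinuousLinearMap.fst ℝ ℝ ℝ) (0, 1) := by
    intro p
    have : ((-(p.2 - c.2), p.1 - c.1) : ℝ × ℝ) =
        -(p.2 - c.2) • ((1 : ℝ), (0 : ℝ)) + (p.1 - c.1) • ((0 : ℝ), (1 : ℝ)) := by simp
    rw [this, map_add, map_smul, map_smul]
    simp
  have hi : IntegrableOn (fun p : ℝ × ℝ => fderiv ℝ ψ p (-(p.2 - c.2), p.1 - c.1))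
      (Icc ((0 : ℝ), (0 : ℝ)) (R, R)) := by
    refine Continuous.integrableOn_Icc ?_
    exact hdc.clm_apply (by fun_prop)
  simp_rw [hsum] at hi ⊢
  rw [integral_divergence_prod_Icc_of_hasFDerivAt_off_countable_of_le _ _ _ _ (0, 0) (R, R)
    ⟨hR, hR⟩ ∅ countable_empty (fun p _ => (hf p).continuousAt.continuousWithinAt)
    (fun p _ => (hg p).continuousAt.continuousWithinAt) (fun p _ => hf p) (fun p _ => hg p) hi]
  simp [h₁, h₂, h₃, h₄]

theorem fderiv_eq_zero_of_lt_norm {φ : EuclideanSpace ℝ (Fin 2) → ℝ} {R : ℝ}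
    (hR : ∀ x, R < ‖x‖ → φ x = 0) (x : EuclideanSpace ℝ (Fin 2)) (hx : R < ‖x‖) :
    fderiv ℝ φ x = 0 := by
  have : φ =ᶠ[nhds x] fun _ => 0 :=
    Filter.mem_of_superset ((isOpen_lt continuous_const continuous_norm).mem_nhds hx)
      fun z hz => hR z hz
  rw [this.fderiv_eq, fderiv_const_apply]

/-- The Biot–Savart kernel is weakly divergence free, tested on the quadrant against functions
vanishing on its boundary. -/
theorem integral_Quadrant_fderiv_perp_eq_zero {φ : EuclideanSpace ℝ (Fin 2) → ℝ}
    (hφ : ContDiff ℝ 1 φ) {R : ℝ} (hR : ∀ x, R < ‖x‖ → φ x = 0)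
    (h₀ : ∀ x, x 0 = 0 → φ x = 0) (h₁ : ∀ x, x 1 = 0 → φ x = 0)
    (y : EuclideanSpace ℝ (Fin 2)) :
    ∫ x in Quadrant, fderiv ℝ φ x (perp (x - y)) / ‖x - y‖ ^ 2 = 0 := by
  have hdc : Continuous (fderiv ℝ φ) := hφ.continuous_fderiv (by simp)
  have hdR := fderiv_eq_zero_of_lt_norm hR
  have hreg : ∀ ε : ℝ, 0 < ε →
      ∫ x in Quadrant, fderiv ℝ φ x (perp (x - y)) / (‖x - y‖ ^ 2 + ε) = 0 := by
    intro ε hε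
    set R' := max R 0 + 1 with hR'
    have hR'0 : 0 ≤ R' := by positivity
    have hRR' : R < R' := by linarith [le_max_left R 0]
    set N : EuclideanSpace ℝ (Fin 2) → ℝ := fun x => (‖x - y‖ ^ 2 + ε)⁻¹ with hN
    have hNpos : ∀ x, ‖x - y‖ ^ 2 + ε ≠ 0 := fun x => by positivity
    have hN0 : ContDiff ℝ 1 fun x : EuclideanSpace ℝ (Fin 2) => ‖x - y‖ ^ 2 + ε :=
      ((contDiff_id.sub contDiff_const).norm_sq ℝ).add contDiff_const
    have hNs : ContDiff ℝ 1 N := hN0.inv hNpos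
    have hNd : ∀ x, fderiv ℝ N x (perp (x - y)) = 0 := by
      intro x
      have e1 : HasFDerivAt (fun x : EuclideanSpace ℝ (Fin 2) => ‖x - y‖ ^ 2 + ε)
          (2 • (innerSL ℝ (x - y)).comp (ContinuousLinearMap.id ℝ _)) x :=
        (((hasFDerivAt_id x).sub_const y).norm_sq).add_const ε
      have e2 := ((hasDerivAt_inv (hNpos x)).comp_hasFDerivAt x e1).fderiv
      change fderiv ℝ (Inv.inv ∘ fun x : EuclideanSpace ℝ (Fin 2) => ‖x - y‖ ^ 2 + ε) x _ = 0
      rw [e2]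
      simp only [ContinuousLinearMap.comp_id, smul_apply, innerSL_apply_apply, inner_perp_self,
        smul_zero]
    set ψ : ℝ × ℝ → ℝ := fun p => φ (planeEquiv p) * N (planeEquiv p) with hψ
    have hψs : ContDiff ℝ 1 ψ :=
      (hφ.comp planeEquiv.contDiff).mul (hNs.comp planeEquiv.contDiff)
    have key : ∀ p : ℝ × ℝ, fderiv ℝ ψ p (-(p.2 - y 1), p.1 - y 0) =
        fderiv ℝ φ (planeEquiv p) (perp (planeEquiv p - y)) /
          (‖planeEquiv p - y‖ ^ 2 + ε) := by
      intro p
      have e1 : HasFDerivAt (fun x => φ x * N x) _ (planeEquiv p) :=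
        ((hφ.differentiable (by simp) (planeEquiv p)).hasFDerivAt).mul
          ((hNs.differentiable (by simp) (planeEquiv p)).hasFDerivAt)
      have e2 := (e1.comp p planeEquiv.hasFDerivAt).fderiv
      have e3 : planeEquiv (-(p.2 - y 1), p.1 - y 0) = perp (planeEquiv p - y) := by
        ext i
        fin_cases i <;> simp [perp]
      change fderiv ℝ ((fun x => φ x * N x) ∘ planeEquiv) p _ = _
      rw [e2]
      rw [ContinuousLinearMap.comp_apply, ContinuousLinearEquiv.coe_coe, e3, add_apply, smul_apply,
        smul_apply, hNd, smul_zero, zero_add, smul_eq_mul, hN, inv_mul_eq_div]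
    rw [setIntegral_Quadrant_eq (R := R') fun x hx => by simp [hdR x (hRR'.trans hx)]]
    simp_rw [← key]
    refine integral_fderiv_rotation_eq_zero hψs hR'0 (y 0, y 1) (fun b => ?_) (fun b => ?_)
      (fun a => ?_) fun a => ?_
    · simp [hψ, h₀ (planeEquiv (0, b)) rfl]
    · have : R < ‖planeEquiv (R', b)‖ := by
        refine hRR'.trans_le ((le_abs_self _).trans ?_)
        exact PiLp.norm_apply_le (planeEquiv (R', b)) 0
      simp [hψ, hR _ this]
    · simp [hψ, h₁ (planeEquiv (a, 0)) rfl]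
    · have : R < ‖planeEquiv (a, R')‖ := by
        refine hRR'.trans_le ((le_abs_self _).trans ?_)
        exact PiLp.norm_apply_le (planeEquiv (a, R')) 1
      simp [hψ, hR _ this]
  have hw : ∀ i : Fin 2, IsBddWithBddSupport fun x => fderiv ℝ φ x (EuclideanSpace.single i 1) :=
    fun i => .of_continuous (hdc.clm_apply continuous_const) fun x hx => by rw [hdR x hx]; rfl
  have hint : Integrable fun x => fderiv ℝ φ x (perp (x - y)) / ‖x - y‖ ^ 2 := by
    simp_rw [map_perp_div]
    exact ((hw 1).integrable_kernel_mul (measurable_bsKernel 0) (abs_bsKernel_le 0) y).sub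
      ((hw 0).integrable_kernel_mul (measurable_bsKernel 1) (abs_bsKernel_le 1) y)
  have hlim : Filter.Tendsto (fun n : ℕ => ∫ x in Quadrant,
      fderiv ℝ φ x (perp (x - y)) / (‖x - y‖ ^ 2 + 1 / ((n : ℝ) + 1))) Filter.atTop
      (nhds (∫ x in Quadrant, fderiv ℝ φ x (perp (x - y)) / ‖x - y‖ ^ 2)) := by
    refine tendsto_integral_of_dominated_convergence _ (fun n => ?_) hint.norm.integrableOn
      (fun n => Filter.Eventually.of_forall fun x => ?_) (Filter.Eventually.of_forall fun x => ?_)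
    · refine (Continuous.div (hdc.clm_apply (continuous_perp.comp (by fun_prop))) (by fun_prop)
        fun x => ?_).aestronglyMeasurable
      positivity
    · rw [norm_div, norm_div]
      by_cases h0 : ‖x - y‖ = 0
      · have : perp (x - y) = 0 := by rw [← norm_eq_zero, norm_perp, h0]
        simp [this]
      · have h1 : 0 < ‖x - y‖ ^ 2 := by positivity
        have h2 : (0 : ℝ) ≤ 1 / ((n : ℝ) + 1) := by positivity
        refine div_le_div_of_nonneg_left (norm_nonneg _) (norm_pos_iff.2 h1.ne') ?_
        rw [Real.norm_of_nonneg h1.le, Real.norm_of_nonneg (by positivity)]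
        linarith
    · by_cases h0 : ‖x - y‖ = 0
      · have : perp (x - y) = 0 := by rw [← norm_eq_zero, norm_perp, h0]
        simp [this]
      · refine Filter.Tendsto.div tendsto_const_nhds ?_ (by positivity)
        simpa using (tendsto_one_div_add_atTop_nhds_zero_nat (𝕜 := ℝ)).const_add (‖x - y‖ ^ 2)
  refine tendsto_nhds_unique hlim ?_
  simp_rw [fun n : ℕ => hreg (1 / ((n : ℝ) + 1)) (by positivity)]
  exact tendsto_const_nhds

/-- `reflect₂` as a linear isometry equivalence. -/
def reflectIsometry : EuclideanSpace ℝ (Fin 2) ≃ₗᵢ[ℝ] EuclideanSpace ℝ (Fin 2) where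
  toLinearEquiv := LinearEquiv.ofInvolutive
    { toFun := reflect₂
      map_add' := fun x y => by ext i; fin_cases i <;> simp [reflect₂, add_comm]
      map_smul' := fun c x => by ext i; fin_cases i <;> simp [reflect₂] }
    fun x => by ext i; fin_cases i <;> simp [reflect₂]
  norm_map' := fun x => by
    change ‖reflect₂ x‖ = ‖x‖
    simp [reflect₂, EuclideanSpace.norm_eq]

@[simp] theorem reflectIsometry_zero (x : EuclideanSpace ℝ (Fin 2)) :
    reflectIsometry x 0 = x 0 := rfl

@[simp] theorem reflectIsometry_one (x : EuclideanSpace ℝ (Fin 2)) :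
    reflectIsometry x 1 = -x 1 := rfl

theorem reflectIsometry_reflectIsometry (x : EuclideanSpace ℝ (Fin 2)) :
    reflectIsometry (reflectIsometry x) = x := by
  ext i; fin_cases i <;> simp

theorem bsKernel_neg (i : Fin 2) (z : EuclideanSpace ℝ (Fin 2)) :
    bsKernel i (-z) = -bsKernel i z := by
  simp [bsKernel, neg_div]

theorem bsKernel_sub_reflect_antisymm (x y : EuclideanSpace ℝ (Fin 2)) :
    bsKernel 0 (x - reflectIsometry y) = -bsKernel 0 (y - reflectIsometry x) := by
  simp only [bsKernel, EuclideanSpace.real_norm_sq_eq, Fin.sum_univ_two, PiLp.sub_apply,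
    reflectIsometry_zero, reflectIsometry_one]
  rw [← neg_div]
  congr 1 <;> ring

namespace IsBddWithBddSupport

variable {w q ω : EuclideanSpace ℝ (Fin 2) → ℝ}

theorem integrable_prod_isometry (hw : IsBddWithBddSupport w) (hq : IsBddWithBddSupport q)
    {k : EuclideanSpace ℝ (Fin 2) → ℝ} (hkm : Measurable k) (hk : ∀ z, |k z| ≤ ‖z‖⁻¹)
    (e : EuclideanSpace ℝ (Fin 2) ≃ₗᵢ[ℝ] EuclideanSpace ℝ (Fin 2)) :
    Integrable (fun z : EuclideanSpace ℝ (Fin 2) × EuclideanSpace ℝ (Fin 2) =>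
      k (z.1 - e z.2) * w z.1 * q z.2) (volume.prod volume) := by
  have h := hw.integrable_prod (hq.comp_isometry e.symm) hkm hk
  have hmp : MeasurePreserving (Prod.map id e) (volume.prod volume) (volume.prod volume) :=
    (MeasurePreserving.id (volume : Measure (EuclideanSpace ℝ (Fin 2)))).prod e.measurePreserving
  have := hmp.integrable_comp_of_integrable h
  simpa [Function.comp_def] using this

theorem integrable_kernel_mul_left (hw : IsBddWithBddSupport w) (i : Fin 2)
    (x : EuclideanSpace ℝ (Fin 2)) : Integrable fun y => bsKernel i (x - y) * w y := by
  refine (hw.integrable_kernel_mul (measurable_bsKernel i) (abs_bsKernel_le i) x).neg.congr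
    (Filter.Eventually.of_forall fun y => ?_)
  change -(bsKernel i (y - x) * w y) = bsKernel i (x - y) * w y
  rw [← neg_sub y x, bsKernel_neg, neg_mul]

theorem map_biotSavart (hω : IsBddWithBddSupport ω) (L : EuclideanSpace ℝ (Fin 2) →L[ℝ] ℝ)
    (x : EuclideanSpace ℝ (Fin 2)) : L (biotSavart ω x) = 1 / (2 * π) *
      ∫ y, (bsKernel 0 (x - y) * L (EuclideanSpace.single 1 1) -
        bsKernel 1 (x - y) * L (EuclideanSpace.single 0 1)) * ω y := by
  have hint : Integrable fun y => (ω y / ‖x - y‖ ^ 2) • perp (x - y) := by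
    refine (((hω.integrable_kernel_mul_left 0 x).smul_const (EuclideanSpace.single 1 (1 : ℝ))).sub
      ((hω.integrable_kernel_mul_left 1 x).smul_const (EuclideanSpace.single 0 (1 : ℝ)))).congr
      (Filter.Eventually.of_forall fun y => ?_)
    simp only [Pi.sub_apply, perp_eq, smul_sub, smul_smul, bsKernel]
    congr 2 <;> ring
  rw [biotSavart, map_smul, smul_eq_mul, ← L.integral_comp_comm hint]
  congr 1
  refine integral_congr_ae (Filter.Eventually.of_forall fun y => ?_)
  dsimp only
  rw [map_smul, smul_eq_mul, ← map_perp_div]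
  ring

theorem integral_mul_map_biotSavart (hω : IsBddWithBddSupport ω)
    {s : EuclideanSpace ℝ (Fin 2) → ℝ} (hs : ContDiff ℝ 1 s) {R : ℝ}
    (hR : ∀ x, R < ‖x‖ → s x = 0) (h₀ : ∀ x, x 0 = 0 → s x = 0) :
    ∫ x in Quadrant, x 1 * fderiv ℝ s x (biotSavart ω x) =
      -(1 / (2 * π) * ∫ y, ∫ x, bsKernel 0 (x - y) * Quadrant.indicator s x * ω y) := by
  have hdc : Continuous (fderiv ℝ s) := hs.continuous_fderiv (by simp)
  have hdR := fderiv_eq_zero_of_lt_norm hR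
  set w : Fin 2 → EuclideanSpace ℝ (Fin 2) → ℝ := fun i =>
    Quadrant.indicator fun x => x 1 * fderiv ℝ s x (EuclideanSpace.single i 1) with hw
  have hwb : ∀ i, IsBddWithBddSupport (w i) := fun i => by
    refine (of_continuous (R := R) ?_ fun x hx => ?_).indicator measurableSet_Quadrant
    · exact Continuous.mul (by fun_prop) (hdc.clm_apply continuous_const)
    · simp [hdR x hx]
  have hp : IsBddWithBddSupport (Quadrant.indicator s) :=
    (of_continuous hs.continuous hR).indicator measurableSet_Quadrant
  have hk := fun i y => (hwb i).integrable_kernel_mul (measurable_bsKernel (1 - i))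
    (abs_bsKernel_le (1 - i)) y
  have hk0 := hk 1
  have hk1 := hk 0
  simp only [sub_self, sub_zero] at hk0 hk1
  have hkp := hp.integrable_kernel_mul (measurable_bsKernel 0) (abs_bsKernel_le 0)
  have hinner : ∀ y, ∫ x, (bsKernel 0 (x - y) * w 1 x - bsKernel 1 (x - y) * w 0 x) =
      -∫ x, bsKernel 0 (x - y) * Quadrant.indicator s x := by
    intro y
    have hφ : ContDiff ℝ 1 fun x : EuclideanSpace ℝ (Fin 2) => x 1 * s x :=
      ContDiff.mul (by fun_prop) hs
    have h := integral_Quadrant_fderiv_perp_eq_zero hφ (R := R) (fun x hx => by simp [hR x hx])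
      (fun x hx => by simp [h₀ x hx]) (fun x hx => by simp [hx]) y
    rw [← integral_indicator measurableSet_Quadrant] at h
    have hsub : Integrable fun x => bsKernel 0 (x - y) * w 1 x - bsKernel 1 (x - y) * w 0 x :=
      (hk0 y).sub (hk1 y)
    rw [eq_neg_iff_add_eq_zero, ← integral_add hsub (hkp y), ← h]
    refine integral_congr_ae (Filter.Eventually.of_forall fun x => ?_)
    by_cases hx : x ∈ Quadrant
    · have hd : fderiv ℝ (fun x : EuclideanSpace ℝ (Fin 2) => x 1 * s x) x =
          x 1 • fderiv ℝ s x + s x • EuclideanSpace.proj (1 : Fin 2) :=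
        (HasFDerivAt.mul ((EuclideanSpace.proj (𝕜 := ℝ) (1 : Fin 2)).hasFDerivAt (x := x))
          ((hs.differentiable (by simp) x).hasFDerivAt)).fderiv
      simp only [hw, indicator_of_mem hx, map_perp_div, hd, add_apply, smul_apply, smul_eq_mul]
      simp
      ring
    · simp [hw, hx]
  have hprod : ∀ i j, Integrable
      (fun z : EuclideanSpace ℝ (Fin 2) × EuclideanSpace ℝ (Fin 2) =>
        bsKernel j (z.1 - z.2) * w i z.1 * ω z.2) (volume.prod volume) := fun i j =>
    (hwb i).integrable_prod hω (measurable_bsKernel j) (abs_bsKernel_le j)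
  have hleft : ∫ x in Quadrant, x 1 * fderiv ℝ s x (biotSavart ω x) = 1 / (2 * π) *
      ∫ x, ∫ y, (bsKernel 0 (x - y) * w 1 x * ω y - bsKernel 1 (x - y) * w 0 x * ω y) := by
    rw [← integral_indicator measurableSet_Quadrant, ← integral_const_mul]
    refine integral_congr_ae (Filter.Eventually.of_forall fun x => ?_)
    by_cases hx : x ∈ Quadrant
    · simp only [hw, indicator_of_mem hx, hω.map_biotSavart]
      rw [mul_left_comm, ← integral_const_mul]
      congr 1
      refine integral_congr_ae (Filter.Eventually.of_forall fun y => ?_)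
      dsimp only
      ring
    · simp [hw, hx]
  rw [hleft, integral_integral_swap ((hprod 1 0).sub (hprod 0 1)), ← mul_neg, ← integral_neg]
  congr 1
  refine integral_congr_ae (Filter.Eventually.of_forall fun y => ?_)
  dsimp only
  simp_rw [← sub_mul]
  rw [integral_mul_const, integral_mul_const, hinner, neg_mul]

theorem integral_kernel_reflect (hp : IsBddWithBddSupport q) :
    ∫ y, ∫ x, bsKernel 0 (x - y) * q x * (q (reflectIsometry y) - q (-y)) =
      -∫ x, ∫ y, bsKernel 0 (x + y) * q y * q x := by
  have hpr := hp.comp_isometry reflectIsometry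
  have hpn := hp.comp_isometry (LinearIsometryEquiv.neg ℝ)
  have hk := hp.integrable_kernel_mul (measurable_bsKernel 0) (abs_bsKernel_le 0)
  have hir : Integrable fun y => ∫ x, bsKernel 0 (x - y) * q x * q (reflectIsometry y) :=
    (hp.integrable_prod hpr (measurable_bsKernel 0) (abs_bsKernel_le 0)).integral_prod_right
  have hin : Integrable fun y => ∫ x, bsKernel 0 (x - y) * q x * q (-y) :=
    (hp.integrable_prod hpn (measurable_bsKernel 0) (abs_bsKernel_le 0)).integral_prod_right
  have hsplit : ∀ y, ∫ x, bsKernel 0 (x - y) * q x * (q (reflectIsometry y) - q (-y)) =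
      (∫ x, bsKernel 0 (x - y) * q x * q (reflectIsometry y)) -
        ∫ x, bsKernel 0 (x - y) * q x * q (-y) := fun y => by
    rw [← integral_sub ((hk y).mul_const _) ((hk y).mul_const _)]
    simp_rw [mul_sub]
  simp_rw [hsplit]
  rw [integral_sub hir hin]
  have hA : ∫ y, ∫ x, bsKernel 0 (x - y) * q x * q (reflectIsometry y) = 0 := by
    have h1 := reflectIsometry.measurePreserving.integral_comp
      reflectIsometry.toHomeomorph.measurableEmbedding
      (fun y => ∫ x, bsKernel 0 (x - reflectIsometry y) * q x * q y)
    simp_rw [reflectIsometry_reflectIsometry] at h1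
    rw [h1]
    have h2 := integral_integral_swap
      (f := fun x y => bsKernel 0 (x - reflectIsometry y) * q x * q y)
      (hp.integrable_prod_isometry hp (measurable_bsKernel 0) (abs_bsKernel_le 0) reflectIsometry)
    have h3 : ∫ x, ∫ y, bsKernel 0 (x - reflectIsometry y) * q x * q y =
        -∫ y, ∫ x, bsKernel 0 (x - reflectIsometry y) * q x * q y := by
      simp_rw [← integral_neg]
      refine integral_congr_ae (Filter.Eventually.of_forall fun x =>
        integral_congr_ae (Filter.Eventually.of_forall fun y => ?_))
      dsimp only
      rw [bsKernel_sub_reflect_antisymm]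
      ring
    linarith
  rw [hA, zero_sub, ← integral_neg_eq_self]
  simp_rw [sub_neg_eq_add, neg_neg, add_comm]

end IsBddWithBddSupport

theorem setIntegral_setIntegral_Quadrant_eq (s : EuclideanSpace ℝ (Fin 2) → ℝ) :
    ∫ x in Quadrant, ∫ y in Quadrant, (x 0 + y 0) / ‖x + y‖ ^ 2 * s y * s x =
      ∫ x, ∫ y, bsKernel 0 (x + y) * Quadrant.indicator s y * Quadrant.indicator s x := by
  rw [← integral_indicator measurableSet_Quadrant]
  refine integral_congr_ae (Filter.Eventually.of_forall fun x => ?_)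
  by_cases hx : x ∈ Quadrant
  · simp only [indicator_of_mem hx]
    rw [← integral_indicator measurableSet_Quadrant]
    refine integral_congr_ae (Filter.Eventually.of_forall fun y => ?_)
    by_cases hy : y ∈ Quadrant <;> simp [hy, bsKernel]
  · simp [hx]

theorem setIntegral_setIntegral_Quadrant_pos {s : EuclideanSpace ℝ (Fin 2) → ℝ}
    (hs : Continuous s) {R : ℝ} (hR : ∀ x, R < ‖x‖ → s x = 0)
    (hsign : (∀ x ∈ Quadrant, s x ≤ 0) ∨ (∀ x ∈ Quadrant, 0 ≤ s x))
    (hne : ¬ ∀ x ∈ Quadrant, s x = 0) :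
    0 < ∫ x in Quadrant, ∫ y in Quadrant, (x 0 + y 0) / ‖x + y‖ ^ 2 * s y * s x := by
  rw [setIntegral_setIntegral_Quadrant_eq]
  set q := Quadrant.indicator s with hq
  have hqb : IsBddWithBddSupport q :=
    (IsBddWithBddSupport.of_continuous hs hR).indicator measurableSet_Quadrant
  have hint : Integrable (fun z : EuclideanSpace ℝ (Fin 2) × EuclideanSpace ℝ (Fin 2) =>
      bsKernel 0 (z.1 + z.2) * q z.2 * q z.1) (volume.prod volume) := by
    refine (hqb.integrable_prod_isometry hqb (measurable_bsKernel 0) (abs_bsKernel_le 0)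
      (LinearIsometryEquiv.neg ℝ)).congr (Filter.Eventually.of_forall fun z => ?_)
    simp only [LinearIsometryEquiv.coe_neg, sub_neg_eq_add]
    ring
  have hk : ∀ x ∈ Quadrant, ∀ y ∈ Quadrant, 0 < bsKernel 0 (x + y) := by
    intro x hx y hy
    have h0 : 0 < (x + y) 0 := add_pos hx.1 hy.1
    have : x + y ≠ 0 := fun h => by simp [h] at h0
    exact div_pos h0 (by positivity)
  have hsq : ∀ x ∈ Quadrant, ∀ y ∈ Quadrant, 0 ≤ s y * s x := fun x hx y hy =>
    hsign.elim (fun h => mul_nonneg_of_nonpos_of_nonpos (h y hy) (h x hx))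
      fun h => mul_nonneg (h y hy) (h x hx)
  rw [integral_integral hint, integral_pos_iff_support_of_nonneg _ hint]
  · push Not at hne
    obtain ⟨x, hx, hsx⟩ := hne
    have hU : IsOpen (Quadrant ∩ {x | s x ≠ 0}) :=
      isOpen_Quadrant.inter (isOpen_ne_fun hs continuous_const)
    refine ((hU.prod hU).measure_pos _ ⟨(x, x), ⟨hx, hsx⟩, ⟨hx, hsx⟩⟩).trans_le
      (measure_mono ?_)
    rintro ⟨y, z⟩ ⟨⟨hy, hsy⟩, ⟨hz, hsz⟩⟩
    rw [Function.mem_support]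
    simp only [hq, indicator_of_mem hy, indicator_of_mem hz]
    exact mul_ne_zero (mul_ne_zero (hk y hy z hz).ne' hsz) hsy
  · rintro ⟨x, y⟩
    by_cases hx : x ∈ Quadrant
    · by_cases hy : y ∈ Quadrant
      · simp only [hq, indicator_of_mem hx, indicator_of_mem hy, Pi.zero_apply, mul_assoc]
        exact mul_nonneg (hk x hx y hy).le (hsq x hx y hy)
      · simp [hq, hy]
    · simp [hq, hx]

/-- Differentiation of the second moment under the integral sign. -/
theorem hasDerivWithinAt_integral_Quadrant {σ : ℝ → EuclideanSpace ℝ (Fin 2) → ℝ}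
    (hσ : ContDiff ℝ 1 fun p : ℝ × EuclideanSpace ℝ (Fin 2) => σ p.1 p.2) {I : Set ℝ} {R : ℝ}
    (hR : ∀ t ∈ I, ∀ x, R < ‖x‖ → σ t x = 0) {t : ℝ} (ht : t ∈ I) :
    HasDerivWithinAt (fun s => ∫ x in Quadrant, x 1 * σ s x)
      (∫ x in Quadrant ∩ Metric.closedBall 0 R, x 1 * deriv (fun s => σ s x) t) I t := by
  set D : Set (EuclideanSpace ℝ (Fin 2)) := Quadrant ∩ Metric.closedBall 0 R with hD
  have hDm : MeasurableSet D := measurableSet_Quadrant.inter Metric.isClosed_closedBall.measurableSet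
  have hDf : volume D ≠ ⊤ :=
    ((measure_mono inter_subset_right).trans_lt (isCompact_closedBall _ _).measure_lt_top).ne
  have hcoord : Continuous fun x : EuclideanSpace ℝ (Fin 2) => x 1 := by fun_prop
  have hx : ∀ x s, HasDerivAt (fun s => σ s x)
      (fderiv ℝ (fun p : ℝ × EuclideanSpace ℝ (Fin 2) => σ p.1 p.2) (s, x) (1, 0)) s := by
    intro x s
    have h1 : HasDerivAt (fun s : ℝ => (s, x)) ((1 : ℝ), (0 : EuclideanSpace ℝ (Fin 2))) s :=
      (hasDerivAt_id s).prodMk (hasDerivAt_const s x)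
    exact ((hσ.differentiable (by simp) (s, x)).hasFDerivAt).comp_hasDerivAt s h1
  have hdc : Continuous fun p : ℝ × EuclideanSpace ℝ (Fin 2) =>
      p.2 1 * deriv (fun s => σ s p.2) p.1 := by
    simp_rw [fun p : ℝ × EuclideanSpace ℝ (Fin 2) => (hx p.2 p.1).deriv]
    exact (hcoord.comp continuous_snd).mul
      ((hσ.continuous_fderiv (by simp)).clm_apply continuous_const)
  obtain ⟨B, hB⟩ := ((isCompact_Icc (a := t - 1) (b := t + 1)).prod
    (isCompact_closedBall (0 : EuclideanSpace ℝ (Fin 2)) R)).exists_bound_of_continuousOn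
    hdc.continuousOn
  have hF : ∀ s, Continuous fun x => x 1 * σ s x := fun s =>
    hcoord.mul (hσ.continuous.comp (f := fun x => (s, x)) (by fun_prop))
  have hmain := (hasDerivAt_integral_of_dominated_loc_of_deriv_le (μ := volume.restrict D)
    (F := fun s x => x 1 * σ s x) (F' := fun s x => x 1 * deriv (fun s => σ s x) s)
    (bound := fun _ => B) (Icc_mem_nhds (sub_one_lt t) (lt_add_one t))
    (Filter.Eventually.of_forall fun s => (hF s).aestronglyMeasurable)
    (((hF t).continuousOn.integrableOn_compact (isCompact_closedBall _ R)).mono_set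
      inter_subset_right)
    (hdc.comp (f := fun x => (t, x)) (by fun_prop)).aestronglyMeasurable
    ((ae_restrict_iff' hDm).2 (Filter.Eventually.of_forall fun x hxD s hs =>
      hB (s, x) ⟨hs, hxD.2⟩))
    (integrableOn_const hDf)
    (Filter.Eventually.of_forall fun x s _ =>
      ((hx x s).differentiableAt.hasDerivAt).const_mul _)).2
  have heq : ∀ s ∈ I, ∫ x in Quadrant, x 1 * σ s x = ∫ x in D, x 1 * σ s x := fun s hs =>
    setIntegral_eq_of_subset_of_forall_sdiff_eq_zero measurableSet_Quadrant inter_subset_left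
      fun x hx => by
        have : R < ‖x‖ := by
          by_contra! h
          exact hx.2 ⟨hx.1, mem_closedBall_zero_iff.2 h⟩
        simp [hR s hs x this]
  exact hmain.hasDerivWithinAt.congr heq (heq t ht)

/-- Evolution of the second restricted barycenter moment
`E₂(t) = ∫_Q x₂ σ₊(t,x) dx` for smooth solutions of the unscreened right-handed
system with the odd/mirror symmetries, support of `σ₊` in the upper half plane,
and a sign condition on `Q`:
`E₂′(t) = (1/2π) ∫_{Q×Q} (x₁+y₁)/|x+y|² σ₊(y)σ₊(x) dy dx > 0`. -/
theorem second_moment_evolution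
    (T : ℝ) (hT : 0 < T)
    (σp σm : ℝ → EuclideanSpace ℝ (Fin 2) → ℝ)
    (hsp : ContDiff ℝ (⊤ : ℕ∞) fun p : ℝ × EuclideanSpace ℝ (Fin 2) => σp p.1 p.2)
    (hsm : ContDiff ℝ (⊤ : ℕ∞) fun p : ℝ × EuclideanSpace ℝ (Fin 2) => σm p.1 p.2)
    (hcp : ∀ t, HasCompactSupport (σp t)) (hcm : ∀ t, HasCompactSupport (σm t))
    (hsol : ∀ t ∈ Icc (0:ℝ) T, ∀ x,
      deriv (fun s => σp s x) t - fderiv ℝ (σp t) x (biotSavart (σm t) x) = 0 ∧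
      deriv (fun s => σm s x) t + fderiv ℝ (σm t) x (biotSavart (σp t) x) = 0)
    (hodd : ∀ t ∈ Icc (0:ℝ) T, ∀ x,
      σp t (reflect₁ x) = -σp t x ∧ σm t (reflect₁ x) = -σm t x)
    (hmirror : ∀ t ∈ Icc (0:ℝ) T, ∀ x, σp t x = σm t (reflect₂ x))
    (hsupp : ∀ t ∈ Icc (0:ℝ) T, ∀ x, σp t x ≠ 0 → 0 < x 1)
    (hsign : ∀ t ∈ Icc (0:ℝ) T,
      (∀ x ∈ Quadrant, σp t x ≤ 0) ∨ (∀ x ∈ Quadrant, 0 ≤ σp t x)) :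
    ∀ t ∈ Icc (0:ℝ) T,
      HasDerivWithinAt (fun s => ∫ x in Quadrant, x 1 * σp s x)
        ((1 / (2 * π)) * ∫ x in Quadrant, ∫ y in Quadrant,
          (x 0 + y 0) / ‖x + y‖ ^ 2 * σp t y * σp t x)
        (Icc (0:ℝ) T) t ∧
      ((¬ ∀ x ∈ Quadrant, σp t x = 0) →
        0 < (1 / (2 * π)) * ∫ x in Quadrant, ∫ y in Quadrant,
          (x 0 + y 0) / ‖x + y‖ ^ 2 * σp t y * σp t x) := by
  have hp1 : ContDiff ℝ 1 fun p : ℝ × EuclideanSpace ℝ (Fin 2) => σp p.1 p.2 :=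
    hsp.of_le (by exact_mod_cast le_top)
  have hmir : ∀ t ∈ Icc (0 : ℝ) T, ∀ x, σm t x = σp t (reflectIsometry x) := fun t ht x => by
    rw [hmirror t ht]
    exact congrArg (σm t) (reflectIsometry_reflectIsometry x).symm
  obtain ⟨C, hC, hbs⟩ := exists_norm_biotSavart_le
  have hself : IsSelfTransported σp T C := by
    intro t ht M R hR hM hsuppR x
    refine ⟨biotSavart (σm t) x, hbs _ M R hR (fun y => ?_) (fun y hy => ?_) x,
      sub_eq_zero.1 (hsol t ht x).1⟩
    · rw [hmir t ht]
      exact hM _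
    · rw [hmir t ht]
      exact hsuppR _ (by simpa using hy)
  obtain ⟨R, hR⟩ := hself.exists_uniform_support hC (hp1.differentiable (by simp)) hcp
  intro t ht
  have hs : ContDiff ℝ 1 (σp t) := hp1.comp (f := fun x => (t, x)) (by fun_prop)
  have h₀ : ∀ x, x 0 = 0 → σp t x = 0 := fun x hx => by
    have h1 := (hodd t ht x).1
    have h2 : reflect₁ x = x := by
      ext i; fin_cases i <;> simp [reflect₁, hx]
    rw [h2] at h1
    linarith
  have hpb := IsBddWithBddSupport.of_continuous hs.continuous (hR t ht)
  have hqb := hpb.indicator measurableSet_Quadrant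
  have hdecomp : ∀ x, σp t x = Quadrant.indicator (σp t) x -
      Quadrant.indicator (σp t) (reflect₁ x) := by
    intro x
    rcases le_or_gt (x 1) 0 with hx1 | hx1
    · have e : σp t x = 0 := by
        by_contra h
        exact (hsupp t ht x h).not_ge hx1
      have n1 : x ∉ Quadrant := fun h => h.2.not_ge hx1
      have n2 : reflect₁ x ∉ Quadrant := fun h => h.2.not_ge hx1
      simp [e, n1, n2]
    rcases lt_trichotomy (x 0) 0 with hx0 | hx0 | hx0
    · have n1 : x ∉ Quadrant := fun h => h.1.not_gt hx0
      have n2 : reflect₁ x ∈ Quadrant := ⟨neg_pos.2 hx0, hx1⟩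
      simp [n1, n2, (hodd t ht x).1]
    · have n1 : x ∉ Quadrant := fun h => h.1.ne' hx0
      have n2 : reflect₁ x ∉ Quadrant := fun h => h.1.ne' (neg_eq_zero.2 hx0)
      simp [n1, n2, h₀ x hx0]
    · have n1 : x ∈ Quadrant := ⟨hx0, hx1⟩
      have n2 : reflect₁ x ∉ Quadrant := fun h => (neg_pos.1 h.1).not_gt hx0
      simp [n1, n2]
  have hω : σm t = fun y => Quadrant.indicator (σp t) (reflectIsometry y) -
      Quadrant.indicator (σp t) (-y) := by
    ext y
    have : reflect₁ (reflectIsometry y) = -y := by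
      ext i; fin_cases i <;> simp [reflect₁]
    rw [hmir t ht, hdecomp, this]
  have hωb : IsBddWithBddSupport (σm t) := by
    rw [show σm t = fun y => σp t (reflectIsometry y) from funext (hmir t ht)]
    exact hpb.comp_isometry _
  have hvalue : ∫ x in Quadrant ∩ Metric.closedBall 0 R, x 1 * deriv (fun s => σp s x) t =
      (1 / (2 * π)) * ∫ x in Quadrant, ∫ y in Quadrant,
        (x 0 + y 0) / ‖x + y‖ ^ 2 * σp t y * σp t x := by
    simp_rw [fun x => sub_eq_zero.1 (hsol t ht x).1]
    have h := hωb.integral_mul_map_biotSavart hs (hR t ht) h₀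
    simp only [congrFun hω] at h
    rw [hqb.integral_kernel_reflect, mul_neg, neg_neg, ← setIntegral_setIntegral_Quadrant_eq] at h
    rw [← h]
    refine (setIntegral_eq_of_subset_of_forall_sdiff_eq_zero measurableSet_Quadrant
      inter_subset_left fun x hx => ?_).symm
    have : R < ‖x‖ := by
      by_contra! hxR
      exact hx.2 ⟨hx.1, mem_closedBall_zero_iff.2 hxR⟩
    simp [fderiv_eq_zero_of_lt_norm (hR t ht) x this]
  exact ⟨hvalue ▸ hasDerivWithinAt_integral_Quadrant hp1 hR ht, fun hne =>
    mul_pos (by positivity)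
      (setIntegral_setIntegral_Quadrant_pos hs.continuous (hR t ht) (hsign t ht) hne)⟩

end
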